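/- arXiv:2210.06672 — 3 statements merged into one kernel-verified Lean document; each statement's English description precedes it below -/
import Mathlib

section
/- (Empirical-variance high-confidence convergence rate, general kernel.) Let X_1, …, X_n be i.i.d. from P (n ≥ 2) and δ ∈ (0,1). With probability at least 1 − δ: ‖μ̂_n − μ_P‖ ≤ √( 2 (v̂ + Δdiag k) log(2/δ)/n ) + ( (16/3)√(Δk) + 2√2·√(Δdiag k) ) · log(2/δ)/n, where v̂ = (1/(n−1)) Σ_{t=1}^n ( k(X_t, X_t) − (1/n) Σ_{s=1}^n k(X_t, X_s) ). -/
open MeasureTheory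
open scoped RealInnerProductSpace

lemma exp_sub_self_le {z b : ℝ} (hz : 0 ≤ z) (hzb : z ≤ b) (hb : b ≤ 1) :
    Real.exp z - z ≤ 1 + z ^ 2 / (2 * (1 - b / 3)) := by
  have h := Real.exp_bound' hz (hzb.trans hb) (n := 4) (by norm_num)
  simp only [Finset.sum_range_succ, Finset.sum_range_zero, Nat.factorial] at h
  norm_num at h
  have h1 : z ^ 2 / (2 * (1 - z / 3)) ≤ z ^ 2 / (2 * (1 - b / 3)) := by
    apply div_le_div_of_nonneg_left <;> nlinarith
  have h2 : z ^ 2 / 2 + z ^ 3 / 6 + z ^ 4 * 5 / 96 ≤ z ^ 2 / (2 * (1 - z / 3)) := by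
    rw [le_div_iff₀ (by linarith)]
    have : 0 ≤ z ^ 4 := by positivity
    have : 0 ≤ z ^ 5 := by positivity
    nlinarith
  linarith

lemma cosh_sqrt_convex {p q s t : ℝ} (hp : 0 ≤ p) (hq : 0 ≤ q) (hs : 0 ≤ s) (ht : 0 ≤ t)
    (hst : s + t = 1) :
    Real.cosh √(s * p + t * q) ≤ s * Real.cosh √p + t * Real.cosh √q := by
  have key : ∀ r : ℝ, 0 ≤ r →
      HasSum (fun n : ℕ => r ^ n / ((2 * n).factorial : ℝ)) (Real.cosh √r) := by
    intro r hr
    have := Real.hasSum_cosh √r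
    simpa only [pow_mul, Real.sq_sqrt hr] using this
  refine hasSum_le ?_ (key _ (by positivity)) (((key p hp).mul_left s).add ((key q hq).mul_left t))
  intro n
  have h := (convexOn_pow n).2 (Set.mem_Ici.2 hp) (Set.mem_Ici.2 hq) hs ht hst
  simp only [smul_eq_mul] at h
  calc _ ≤ (s * p ^ n + t * q ^ n) / ((2 * n).factorial : ℝ) := by gcongr
    _ = _ := by ring

lemma cosh_add_le {a b : ℝ} (hb : 0 ≤ b) :
    Real.cosh (a + b) ≤ Real.cosh a * (Real.exp b - b) + b * Real.sinh a := by
  have h1 : Real.sinh a ≤ Real.cosh a := (Real.sinh_lt_cosh a).le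
  have h2 := Real.self_le_sinh_iff.2 hb
  rw [Real.cosh_add, ← Real.cosh_add_sinh b]
  nlinarith [mul_nonneg (sub_nonneg.2 h1) (sub_nonneg.2 h2)]

lemma cosh_norm_add_le {H : Type*} [NormedAddCommGroup H] [InnerProductSpace ℝ H] (x y : H) :
    Real.cosh ‖x + y‖ ≤ Real.cosh ‖x‖ * (Real.exp ‖y‖ - ‖y‖)
      + ⟪(Real.sinh ‖x‖ / ‖x‖) • x, y⟫ := by
  rcases eq_or_ne x 0 with rfl | hx
  · have := cosh_add_le (a := 0) (norm_nonneg y)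
    simpa using this
  rcases eq_or_ne y 0 with rfl | hy
  · simp
  have ha : 0 < ‖x‖ := norm_pos_iff.2 hx
  have hb : 0 < ‖y‖ := norm_pos_iff.2 hy
  obtain ⟨c, hc⟩ : ∃ c, c = ⟪x, y⟫ / (‖x‖ * ‖y‖) := ⟨_, rfl⟩
  have hin : ⟪x, y⟫ = c * (‖x‖ * ‖y‖) := by rw [hc]; field_simp
  have hcabs : |c| ≤ 1 := by rw [hc]; exact abs_real_inner_div_norm_mul_norm_le_one x y
  obtain ⟨hc1, hc2⟩ := abs_le.1 hcabs
  have hnorm : ‖x + y‖ = √((1 + c) / 2 * (‖x‖ + ‖y‖) ^ 2 + (1 - c) / 2 * (‖x‖ + -‖y‖) ^ 2) := by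
    rw [← Real.sqrt_sq (norm_nonneg (x + y)), norm_add_sq_real, hin]
    congr 1
    ring
  have hconv := cosh_sqrt_convex (sq_nonneg (‖x‖ + ‖y‖)) (sq_nonneg (‖x‖ + -‖y‖))
    (s := (1 + c) / 2) (t := (1 - c) / 2) (by linarith) (by linarith) (by ring)
  rw [← hnorm, Real.sqrt_sq_eq_abs, Real.sqrt_sq_eq_abs, Real.cosh_abs, Real.cosh_abs] at hconv
  have h1 := cosh_add_le (a := ‖x‖) hb.le
  have h2 : Real.cosh (‖x‖ + -‖y‖) ≤
      Real.cosh ‖x‖ * (Real.exp ‖y‖ - ‖y‖) - ‖y‖ * Real.sinh ‖x‖ := by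
    have := cosh_add_le (a := -‖x‖) hb.le
    rw [Real.cosh_neg, Real.sinh_neg] at this
    rw [← Real.cosh_neg, neg_add, neg_neg]
    linarith
  have hinner : ⟪(Real.sinh ‖x‖ / ‖x‖) • x, y⟫ = c * (‖y‖ * Real.sinh ‖x‖) := by
    rw [real_inner_smul_left, hin]; field_simp
  rw [hinner]
  nlinarith [mul_le_mul_of_nonneg_left h1 (by linarith : 0 ≤ (1 + c) / 2),
    mul_le_mul_of_nonneg_left h2 (by linarith : 0 ≤ (1 - c) / 2)]

section Pinelis

lemma integrable_cosh_norm {H : Type*} [NormedAddCommGroup H] [MeasurableSpace H] [BorelSpace H]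
    {Ω : Type*} [MeasurableSpace Ω] {Q : Measure Ω} [IsFiniteMeasure Q]
    {f : Ω → H} (hf : Measurable f) {c : ℝ} (hc : ∀ ω, ‖f ω‖ ≤ c) :
    Integrable (fun ω => Real.cosh ‖f ω‖) Q := by
  refine Integrable.of_bound (C := Real.cosh c)
    (Real.measurable_cosh.comp hf.norm).aestronglyMeasurable (.of_forall fun ω => ?_)
  rw [Real.norm_eq_abs, abs_of_pos (Real.cosh_pos _), Real.cosh_le_cosh, abs_of_nonneg (norm_nonneg _)]
  exact (hc ω).trans (le_abs_self c)

variable {X : Type*} [MeasurableSpace X] {H : Type*} [NormedAddCommGroup H]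
  [InnerProductSpace ℝ H] [CompleteSpace H] [SecondCountableTopology H] [MeasurableSpace H]
  [BorelSpace H] {P : Measure X} [IsProbabilityMeasure P]

lemma integral_cosh_norm_add_le {Y : X → H} (hY : Measurable Y) {b : ℝ} (hb : ∀ x, ‖Y x‖ ≤ b)
    (hb1 : b ≤ 1) (hmean : ∫ x, Y x ∂P = 0) (x₀ : H) :
    ∫ x, Real.cosh ‖x₀ + Y x‖ ∂P ≤
      Real.cosh ‖x₀‖ * (1 + (∫ x, ‖Y x‖ ^ 2 ∂P) / (2 * (1 - b / 3))) := by
  have hYint : Integrable Y P := Integrable.of_bound hY.aestronglyMeasurable b (.of_forall hb)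
  have hsq : Integrable (fun x => ‖Y x‖ ^ 2) P := by
    refine Integrable.of_bound (C := b ^ 2) (hY.norm.pow_const 2).aestronglyMeasurable
      (.of_forall fun x => ?_)
    rw [Real.norm_eq_abs, abs_of_nonneg (by positivity)]
    exact pow_le_pow_left₀ (norm_nonneg _) (hb x) 2
  have hin : Integrable (fun x => ⟪(Real.sinh ‖x₀‖ / ‖x₀‖) • x₀, Y x⟫) P := hYint.const_inner _
  calc ∫ x, Real.cosh ‖x₀ + Y x‖ ∂P
      ≤ ∫ x, (Real.cosh ‖x₀‖ * (1 + ‖Y x‖ ^ 2 / (2 * (1 - b / 3)))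
          + ⟪(Real.sinh ‖x₀‖ / ‖x₀‖) • x₀, Y x⟫) ∂P := by
        refine integral_mono (integrable_cosh_norm (measurable_const.add hY) (c := ‖x₀‖ + b)
          fun x => (norm_add_le _ _).trans (by gcongr; exact hb x)) ?_ fun x => ?_
        · exact (((integrable_const _).add (hsq.div_const _)).const_mul _).add hin
        · have h1 := cosh_norm_add_le x₀ (Y x)
          have h2 := exp_sub_self_le (norm_nonneg (Y x)) (hb x) hb1
          have h3 := mul_le_mul_of_nonneg_left h2 (Real.cosh_pos ‖x₀‖).le
          simp only
          linarith
    _ = _ := by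
        have h1 : Integrable (fun x => 1 + ‖Y x‖ ^ 2 / (2 * (1 - b / 3))) P :=
          (integrable_const _).add (hsq.div_const _)
        rw [integral_add (h1.const_mul _) hin, integral_const_mul,
          integral_add (integrable_const _) (hsq.div_const _), integral_div,
          integral_inner hYint, hmean]
        simp

lemma integral_pi_succ {n : ℕ} {f : (Fin (n + 1) → X) → ℝ}
    (hf : Integrable f (Measure.pi fun _ => P)) :
    ∫ ω, f ω ∂(Measure.pi fun _ => P) =
      ∫ ω, ∫ x, f (Fin.cons x ω) ∂P ∂(Measure.pi fun _ : Fin n => P) := by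
  have h := (measurePreserving_piFinSuccAbove (fun _ : Fin (n + 1) => P) 0).symm
  rw [← h.integral_comp' f, integral_prod_symm]
  · simp [MeasurableEquiv.piFinSuccAbove_symm_apply, Fin.insertNthEquiv]
  · exact h.integrable_comp_of_integrable hf

lemma integral_cosh_norm_sum_le {Y : X → H} (hY : Measurable Y) {b : ℝ} (hb : ∀ x, ‖Y x‖ ≤ b)
    (hb1 : b ≤ 1) (hmean : ∫ x, Y x ∂P = 0) (n : ℕ) :
    ∫ ω, Real.cosh ‖∑ i, Y (ω i)‖ ∂(Measure.pi fun _ : Fin n => P) ≤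
      (1 + (∫ x, ‖Y x‖ ^ 2 ∂P) / (2 * (1 - b / 3))) ^ n := by
  have hint : ∀ n : ℕ, Integrable (fun ω : Fin n → X => Real.cosh ‖∑ i, Y (ω i)‖)
      (Measure.pi fun _ => P) := by
    intro n
    refine integrable_cosh_norm (Finset.measurable_sum _ fun i _ =>
      hY.comp (measurable_pi_apply i)) (c := n * b) fun ω => ?_
    refine (norm_sum_le _ _).trans ((Finset.sum_le_sum fun i _ => hb (ω i)).trans ?_)
    simp
  have hK : 0 ≤ 1 + (∫ x, ‖Y x‖ ^ 2 ∂P) / (2 * (1 - b / 3)) := by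
    have : 0 ≤ ∫ x, ‖Y x‖ ^ 2 ∂P := integral_nonneg fun x => by positivity
    have : 0 ≤ 2 * (1 - b / 3) := by linarith
    positivity
  induction n with
  | zero => simp
  | succ n ih =>
    rw [integral_pi_succ (hint _)]
    calc _ ≤ ∫ ω, Real.cosh ‖∑ i, Y (ω i)‖ * (1 + (∫ x, ‖Y x‖ ^ 2 ∂P) / (2 * (1 - b / 3)))
          ∂(Measure.pi fun _ : Fin n => P) := by
          refine integral_mono_of_nonneg (.of_forall fun ω => integral_nonneg fun x =>
            (Real.cosh_pos _).le) ((hint n).mul_const _) (.of_forall fun ω => ?_)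
          have := integral_cosh_norm_add_le hY hb hb1 hmean (∑ i, Y (ω i))
          simpa [Fin.sum_univ_succ, add_comm] using this
      _ ≤ _ := by
          rw [integral_mul_const, pow_succ]
          gcongr

/-- A Bernstein-type inequality for sums of i.i.d. bounded centred vectors in a Hilbert space. -/
lemma measure_norm_sum_ge_le {Y : X → H} (hY : Measurable Y) {b : ℝ} (hb : ∀ x, ‖Y x‖ ≤ b)
    (hmean : ∫ x, Y x ∂P = 0) (n : ℕ) {a τ : ℝ} (ha : 0 ≤ a) (hab : a * b ≤ 1)
    (hτ : 0 ≤ τ) :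
    (Measure.pi fun _ : Fin n => P).real {ω | τ ≤ ‖∑ i, Y (ω i)‖} ≤
      Real.exp (n * (a ^ 2 * ∫ x, ‖Y x‖ ^ 2 ∂P) / (2 * (1 - a * b / 3))) / Real.cosh (a * τ) := by
  have hZ : Measurable fun x => a • Y x := hY.const_smul a
  have hZb : ∀ x, ‖a • Y x‖ ≤ a * b := fun x => by
    rw [norm_smul, Real.norm_of_nonneg ha]
    exact mul_le_mul_of_nonneg_left (hb x) ha
  have hZmean : ∫ x, a • Y x ∂P = 0 := by rw [integral_smul, hmean, smul_zero]
  have hZint : Integrable (fun ω : Fin n → X => Real.cosh ‖∑ i, a • Y (ω i)‖)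
      (Measure.pi fun _ => P) := by
    refine integrable_cosh_norm (Finset.measurable_sum _ fun i _ =>
      hZ.comp (measurable_pi_apply i)) (c := n * (a * b)) fun ω => ?_
    refine (norm_sum_le _ _).trans ((Finset.sum_le_sum fun i _ => hZb (ω i)).trans ?_)
    simp
  have hsecond : ∫ x, ‖a • Y x‖ ^ 2 ∂P = a ^ 2 * ∫ x, ‖Y x‖ ^ 2 ∂P := by
    simp [norm_smul, mul_pow, integral_const_mul]
  have hmarkov := mul_meas_ge_le_integral_of_nonneg
    (.of_forall fun ω => (Real.cosh_pos _).le) hZint (Real.cosh (a * τ))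
  have hbound := integral_cosh_norm_sum_le hZ hZb hab hZmean n
  rw [hsecond] at hbound
  have hsub : {ω : Fin n → X | τ ≤ ‖∑ i, Y (ω i)‖} ⊆
      {ω | Real.cosh (a * τ) ≤ Real.cosh ‖∑ i, a • Y (ω i)‖} := by
    intro ω hω
    simp only [Set.mem_ofPred_eq] at hω ⊢
    rw [Real.cosh_le_cosh, ← Finset.smul_sum, norm_smul, Real.norm_of_nonneg ha,
      abs_of_nonneg (by positivity), abs_of_nonneg (by positivity)]
    gcongr
  rw [le_div_iff₀ (Real.cosh_pos _), mul_comm]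
  calc _ ≤ Real.cosh (a * τ) * (Measure.pi fun _ : Fin n => P).real
        {ω | Real.cosh (a * τ) ≤ Real.cosh ‖∑ i, a • Y (ω i)‖} :=
        mul_le_mul_of_nonneg_left (measureReal_mono hsub) (Real.cosh_pos _).le
    _ ≤ _ := hmarkov.trans hbound
    _ ≤ Real.exp ((a ^ 2 * ∫ x, ‖Y x‖ ^ 2 ∂P) / (2 * (1 - a * b / 3))) ^ n := by
        have : 0 ≤ ∫ x, ‖Y x‖ ^ 2 ∂P := integral_nonneg fun x => by positivity
        have : 0 ≤ 2 * (1 - a * b / 3) := by linarith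
        gcongr
        rw [add_comm]
        exact Real.add_one_le_exp _
    _ = _ := by rw [← Real.exp_nat_mul, mul_div_assoc (n : ℝ)]

end Pinelis

section PairAverage

lemma sum_perm_pair_eq {ι : Type*} [Fintype ι] [DecidableEq ι] (G : ι → ι → ℝ)
    {i j k l : ι} (hij : i ≠ j) (hkl : k ≠ l) :
    ∑ σ : Equiv.Perm ι, G (σ i) (σ j) = ∑ σ : Equiv.Perm ι, G (σ k) (σ l) := by
  set τ : Equiv.Perm ι := Equiv.swap (Equiv.swap i k j) l * Equiv.swap i k with hτ
  have h1 : τ i = k := by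
    have h : Equiv.swap i k j ≠ k := fun h =>
      hij ((Equiv.swap i k).injective (by rw [h, Equiv.swap_apply_left]))
    simp only [hτ, Equiv.Perm.mul_apply, Equiv.swap_apply_left]
    exact Equiv.swap_apply_of_ne_of_ne h.symm hkl
  have h2 : τ j = l := by simp [hτ, Equiv.Perm.mul_apply]
  rw [← Equiv.sum_comp (Equiv.mulRight τ) fun σ => G (σ i) (σ j)]
  simp [h1, h2]

lemma card_mul_sum_perm_pair {ι : Type*} [Fintype ι] [DecidableEq ι] (G : ι → ι → ℝ)
    (hG : ∀ i, G i i = 0) {k l : ι} (hkl : k ≠ l) :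
    (Fintype.card ι : ℝ) * (Fintype.card ι - 1) * ∑ σ : Equiv.Perm ι, G (σ k) (σ l) =
      Fintype.card (Equiv.Perm ι) * ∑ i, ∑ j, G i j := by
  have h1 : ∑ i, ∑ j, ∑ σ : Equiv.Perm ι, G (σ i) (σ j) =
      Fintype.card (Equiv.Perm ι) * ∑ i, ∑ j, G i j := by
    have : ∀ σ : Equiv.Perm ι, ∑ i, ∑ j, G (σ i) (σ j) = ∑ i, ∑ j, G i j := fun σ => by
      rw [← Equiv.sum_comp σ fun i => ∑ j, G i j]
      exact Finset.sum_congr rfl fun i _ => Equiv.sum_comp σ fun j => G (σ i) j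
    calc _ = ∑ σ : Equiv.Perm ι, ∑ i, ∑ j, G (σ i) (σ j) := by
          rw [Finset.sum_comm (s := (Finset.univ : Finset (Equiv.Perm ι)))]
          exact Finset.sum_congr rfl fun i _ => Finset.sum_comm
      _ = _ := by simp [this]
  rw [← h1]
  have h2 : ∀ i j, ∑ σ : Equiv.Perm ι, G (σ i) (σ j) =
      (1 - if i = j then 1 else 0) * ∑ σ : Equiv.Perm ι, G (σ k) (σ l) := by
    intro i j
    split_ifs with h
    · simp [h, hG]
    · rw [sum_perm_pair_eq G h hkl]; ring
  rw [Finset.sum_congr rfl fun i _ => Finset.sum_congr rfl fun j _ => h2 i j]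
  simp only [← Finset.sum_mul, Finset.sum_sub_distrib]
  congr 1
  simp
  ring

end PairAverage

section LowerTail

open ProbabilityTheory

variable {X : Type*} [MeasurableSpace X] {P : Measure X} [IsProbabilityMeasure P]

lemma integral_prod_pairs {ι κ : Type*} [Fintype ι] [DecidableEq ι] [DecidableEq κ]
    {g : X × X → ℝ}
    (hg : Measurable g) {a b : κ → ι} (ha : a.Injective) (hb : b.Injective)
    (hab : ∀ i j, a i ≠ b j) (s : Finset κ) :
    ∫ ω, ∏ j ∈ s, g (ω (a j), ω (b j)) ∂(Measure.pi fun _ : ι => P) =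
      (∫ z, g z ∂(P.prod P)) ^ s.card := by
  have hind : iIndepFun (fun (i : ι) (ω : ι → X) => ω i) (Measure.pi fun _ : ι => P) :=
    iIndepFun_pi (X := fun _ x => x) fun _ => aemeasurable_id
  have hm : ∀ i : ι, Measurable fun ω : ι → X => ω i := fun i => measurable_pi_apply i
  have hpair : ∀ i j : ι, i ≠ j →
      ∫ ω, g (ω i, ω j) ∂(Measure.pi fun _ : ι => P) = ∫ z, g z ∂(P.prod P) := by
    intro i j hij
    have h := (indepFun_iff_map_prod_eq_prod_map_map (hm i).aemeasurable
      (hm j).aemeasurable).1 (hind.indepFun hij)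
    have e : ∀ i : ι, Measure.map (fun ω : ι → X => ω i) (Measure.pi fun _ : ι => P) = P :=
      fun i => (measurePreserving_eval (fun _ : ι => P) i).map_eq
    rw [e, e] at h
    rw [← h, integral_map ((hm i).prodMk (hm j)).aemeasurable hg.aestronglyMeasurable]
  induction s using Finset.induction_on with
  | empty => simp
  | insert j s hj ih =>
    have hdisj : Disjoint {a j, b j} (s.image a ∪ s.image b) := by
      rw [Finset.disjoint_left]
      intro x hx hx'
      simp only [Finset.mem_insert, Finset.mem_singleton, Finset.mem_union,
        Finset.mem_image] at hx hx'
      rcases hx with rfl | rfl <;> rcases hx' with ⟨i, hi, h⟩ | ⟨i, hi, h⟩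
      · exact hj (ha h ▸ hi)
      · exact hab _ _ h.symm
      · exact hab _ _ h
      · exact hj (hb h ▸ hi)
    have h := hind.indepFun_finset _ _ hdisj hm
    let F : (({a j, b j} : Finset ι) → X) → ℝ := fun u =>
      g (u ⟨a j, by simp⟩, u ⟨b j, by simp⟩)
    let K : ((s.image a ∪ s.image b : Finset ι) → X) → ℝ := fun u =>
      ∏ i ∈ s.attach, g (u ⟨a i, Finset.mem_union_left _ (Finset.mem_image_of_mem a i.2)⟩,
        u ⟨b i, Finset.mem_union_right _ (Finset.mem_image_of_mem b i.2)⟩)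
    have hF : Measurable F := by fun_prop
    have hK : Measurable K := by fun_prop
    have h' := h.comp hF hK
    have hKeq : ∀ ω : ι → X, ∏ i ∈ s, g (ω (a i), ω (b i)) =
        K fun i => ω i := fun ω => by
      simp only [K]
      rw [Finset.prod_attach s fun i => g (ω (a i), ω (b i))]
    have := h'.integral_mul_eq_mul_integral
      (hF.comp (by fun_prop)).aestronglyMeasurable (hK.comp (by fun_prop)).aestronglyMeasurable
    rw [Finset.card_insert_of_notMem hj, pow_succ', ← ih, ← hpair _ _ (hab j j)]
    simp only [Finset.prod_insert hj, hKeq]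
    exact this

lemma integral_exp_neg_mul_le {Ω : Type*} [MeasurableSpace Ω] {Q : Measure Ω}
    [IsProbabilityMeasure Q] {g : Ω → ℝ} (hg : Measurable g) (h0 : ∀ z, 0 ≤ g z)
    (h1 : ∀ z, g z ≤ 1) (s : ℝ) :
    ∫ z, Real.exp (-(s * g z)) ∂Q ≤ Real.exp (-((∫ z, g z ∂Q) * (1 - Real.exp (-s)))) := by
  have hint : Integrable g Q := Integrable.of_bound (C := 1) hg.aestronglyMeasurable
    (.of_forall fun z => by rw [Real.norm_of_nonneg (h0 z)]; exact h1 z)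
  calc ∫ z, Real.exp (-(s * g z)) ∂Q ≤ ∫ z, (1 - g z * (1 - Real.exp (-s))) ∂Q := by
        refine integral_mono_of_nonneg (.of_forall fun z => (Real.exp_pos _).le)
          ((integrable_const _).sub (hint.mul_const _)) (.of_forall fun z => ?_)
        have h := convexOn_exp.2 (Set.mem_univ (-s)) (Set.mem_univ 0) (h0 z)
          (sub_nonneg.2 (h1 z)) (by ring)
        simp only [smul_eq_mul, mul_zero, add_zero, Real.exp_zero, mul_one] at h
        simp only [show -(s * g z) = g z * -s by ring]
        linarith
    _ = 1 - (∫ z, g z ∂Q) * (1 - Real.exp (-s)) := by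
        rw [integral_sub (integrable_const _) (hint.mul_const _), integral_mul_const]
        simp
    _ ≤ _ := by
        have := Real.add_one_le_exp (-((∫ z, g z ∂Q) * (1 - Real.exp (-s))))
        linarith

lemma exp_neg_pairAverage_le {n m : ℕ} (hn : 2 ≤ n) (G : Fin n → Fin n → ℝ)
    (hG : ∀ i, G i i = 0) {a b : Fin m → Fin n} (hab : ∀ i j, a i ≠ b j) :
    Real.exp (-(m * ((∑ i, ∑ j, G i j) / (n * (n - 1))))) ≤
      ∑ σ : Equiv.Perm (Fin n), (Fintype.card (Equiv.Perm (Fin n)) : ℝ)⁻¹ *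
        ∏ j, Real.exp (-G (σ (a j)) (σ (b j))) := by
  have hn' : (2 : ℝ) ≤ n := by exact_mod_cast hn
  have hcard : (Fintype.card (Equiv.Perm (Fin n)) : ℝ) ≠ 0 := by
    exact_mod_cast Fintype.card_ne_zero
  have hpair : ∀ j, ∑ σ : Equiv.Perm (Fin n), G (σ (a j)) (σ (b j)) =
      Fintype.card (Equiv.Perm (Fin n)) * ((∑ i, ∑ j, G i j) / (n * (n - 1))) := by
    intro j
    have h := card_mul_sum_perm_pair G hG (hab j j)
    rw [Fintype.card_fin] at h
    have : (n : ℝ) - 1 ≠ 0 := by linarith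
    field_simp
    linarith
  have hexp : -(m * ((∑ i, ∑ j, G i j) / (n * (n - 1)))) =
      ∑ σ : Equiv.Perm (Fin n), (Fintype.card (Equiv.Perm (Fin n)) : ℝ)⁻¹ •
        ∑ j, -G (σ (a j)) (σ (b j)) := by
    simp only [smul_eq_mul]
    rw [← Finset.mul_sum, Finset.sum_comm (s := (Finset.univ : Finset (Equiv.Perm (Fin n))))]
    simp only [Finset.sum_neg_distrib, hpair]
    rw [Finset.sum_const, Finset.card_univ, Fintype.card_fin, nsmul_eq_mul]
    field_simp
  rw [hexp]
  refine (convexOn_exp.map_sum_le (fun _ _ => by positivity) ?_ fun _ _ => Set.mem_univ _).trans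
    (le_of_eq ?_)
  · rw [Finset.sum_const, Finset.card_univ, nsmul_eq_mul, mul_inv_cancel₀ hcard]
  · simp only [smul_eq_mul, Real.exp_sum]

/-- Lower tail bound for a second-order U-statistic with a bounded nonnegative kernel. -/
lemma measure_pairAverage_le_le {h : X → X → ℝ} (hm : Measurable (Function.uncurry h))
    (h0 : ∀ x y, 0 ≤ h x y) {K : ℝ} (hK : 0 < K) (hle : ∀ x y, h x y ≤ K)
    (hdiag : ∀ x, h x x = 0) {n m : ℕ} (hn : 2 ≤ n) (hmn : 2 * m ≤ n) {V q : ℝ}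
    (hV : ∫ z, h z.1 z.2 ∂(P.prod P) = V) (hq0 : 0 < q) (hq1 : q ≤ 1) :
    (Measure.pi fun _ : Fin n => P).real
        {ω | (∑ i, ∑ j, h (ω i) (ω j)) / (n * (n - 1)) ≤ q ^ 2 * V} ≤
      Real.exp (-(m * (V / K) * (1 - q) ^ 2)) := by
  have hs : 0 ≤ -(2 * Real.log q) := by
    have := Real.log_nonpos hq0.le hq1
    linarith
  obtain ⟨s, hs_def⟩ : ∃ s, s = -(2 * Real.log q) := ⟨_, rfl⟩
  rw [← hs_def] at hs
  have hexps : Real.exp (-s) = q ^ 2 := by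
    rw [hs_def, neg_neg, ← Real.log_rpow hq0, Real.exp_log (by positivity)]
    norm_num
  have hV0 : 0 ≤ V := hV ▸ integral_nonneg fun z => h0 _ _
  let g : X × X → ℝ := fun z => Real.exp (-(s * (h z.1 z.2 / K)))
  have hgm : Measurable g :=
    Real.measurable_exp.comp (((hm.div_const K).const_mul s).neg)
  have hg0 : ∀ z, 0 < g z := fun z => Real.exp_pos _
  have hg1 : ∀ z, g z ≤ 1 := fun z => by
    have : 0 ≤ h z.1 z.2 := h0 _ _
    exact Real.exp_le_one_iff.2 (by simp only [Left.neg_nonpos_iff]; positivity)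
  have hI : ∫ z, g z ∂(P.prod P) ≤ Real.exp (-(V / K * (1 - q ^ 2))) := by
    have := integral_exp_neg_mul_le (Q := P.prod P) (g := fun z => h z.1 z.2 / K)
      (hm.div_const K) (fun z => div_nonneg (h0 _ _) hK.le)
      (fun z => (div_le_one hK).2 (hle _ _)) s
    rwa [integral_div, hV, hexps] at this
  let a : Fin m → Fin n := fun j => ⟨j, by omega⟩
  let b : Fin m → Fin n := fun j => ⟨m + j, by omega⟩
  have ha : a.Injective := fun i j hij => by simpa [a, Fin.ext_iff] using hij
  have hb : b.Injective := fun i j hij => by simpa [b, Fin.ext_iff] using hij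
  have hab : ∀ i j, a i ≠ b j := fun i j hij => by
    simp only [a, b, Fin.mk.injEq] at hij
    omega
  let N : ℝ := Fintype.card (Equiv.Perm (Fin n))
  have hprodm : ∀ σ : Equiv.Perm (Fin n),
      Measurable fun ω : Fin n → X => ∏ j, g (ω (σ (a j)), ω (σ (b j))) := fun σ =>
    Finset.measurable_prod _ fun j _ => hgm.comp (by fun_prop)
  have hprodint : ∀ σ : Equiv.Perm (Fin n),
      Integrable (fun ω : Fin n → X => ∏ j, g (ω (σ (a j)), ω (σ (b j))))
        (Measure.pi fun _ => P) := fun σ => by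
    refine Integrable.of_bound (C := 1) (hprodm σ).aestronglyMeasurable (.of_forall fun ω => ?_)
    rw [Real.norm_of_nonneg (Finset.prod_nonneg fun j _ => (hg0 _).le)]
    exact Finset.prod_le_one (fun j _ => (hg0 _).le) fun j _ => hg1 _
  let R : (Fin n → X) → ℝ := fun ω => ∑ σ : Equiv.Perm (Fin n), N⁻¹ *
    ∏ j, g (ω (σ (a j)), ω (σ (b j)))
  have hRint : Integrable R (Measure.pi fun _ => P) :=
    integrable_finsetSum _ fun σ _ => (hprodint σ).const_mul _
  have hRmean : ∫ ω, R ω ∂(Measure.pi fun _ => P) = (∫ z, g z ∂(P.prod P)) ^ m := by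
    simp only [R]
    rw [integral_finsetSum _ fun σ _ => (hprodint σ).const_mul _]
    have : ∀ σ : Equiv.Perm (Fin n), ∫ ω : Fin n → X, N⁻¹ * ∏ j, g (ω (σ (a j)), ω (σ (b j)))
        ∂(Measure.pi fun _ => P) = N⁻¹ * (∫ z, g z ∂(P.prod P)) ^ m := fun σ => by
      rw [integral_const_mul, integral_prod_pairs (a := fun j => σ (a j))
        (b := fun j => σ (b j)) hgm (σ.injective.comp ha) (σ.injective.comp hb)
        (fun i j h => hab i j (σ.injective h))]
      simp
    rw [Finset.sum_congr rfl fun σ _ => this σ, Finset.sum_const, Finset.card_univ, nsmul_eq_mul,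
      ← mul_assoc, mul_inv_cancel₀, one_mul]
    exact_mod_cast Fintype.card_ne_zero
  have hmarkov := mul_meas_ge_le_integral_of_nonneg (.of_forall fun ω =>
    Finset.sum_nonneg fun σ _ => mul_nonneg (by positivity)
      (Finset.prod_nonneg fun j _ => (hg0 _).le)) hRint
    (Real.exp (-(m * (s / K * (q ^ 2 * V)))))
  rw [hRmean] at hmarkov
  have hsub : {ω : Fin n → X | (∑ i, ∑ j, h (ω i) (ω j)) / (n * (n - 1)) ≤ q ^ 2 * V} ⊆
      {ω | Real.exp (-(m * (s / K * (q ^ 2 * V)))) ≤ R ω} := by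
    intro ω hω
    simp only [Set.mem_ofPred_eq] at hω ⊢
    refine le_trans ?_ (exp_neg_pairAverage_le hn (fun i j => s * (h (ω i) (ω j) / K))
      (fun i => by simp [hdiag]) hab)
    have : ∑ i, ∑ j, s * (h (ω i) (ω j) / K) = s / K * ∑ i, ∑ j, h (ω i) (ω j) := by
      simp only [Finset.mul_sum]
      exact Finset.sum_congr rfl fun i _ => Finset.sum_congr rfl fun j _ => by ring
    rw [this, mul_div_assoc]
    gcongr
  have hlog : q ^ 2 * s ≤ 2 * q - 2 * q ^ 2 := by
    have h1 := Real.one_sub_inv_le_log_of_pos hq0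
    have h2 : q ^ 2 * (1 - q⁻¹) = q ^ 2 - q := by field_simp
    have h3 := mul_le_mul_of_nonneg_left h1 (sq_nonneg q)
    rw [hs_def]
    linarith
  have hfin : (Measure.pi fun _ : Fin n => P).real
        {ω | (∑ i, ∑ j, h (ω i) (ω j)) / (n * (n - 1)) ≤ q ^ 2 * V} ≤
      Real.exp (-(V / K * (1 - q ^ 2))) ^ m / Real.exp (-(m * (s / K * (q ^ 2 * V)))) := by
    rw [le_div_iff₀ (Real.exp_pos _), mul_comm]
    refine (mul_le_mul_of_nonneg_left (measureReal_mono hsub) (Real.exp_pos _).le).trans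
      (hmarkov.trans ?_)
    exact pow_le_pow_left₀ (integral_nonneg fun z => (hg0 z).le) hI m
  refine hfin.trans ?_
  rw [← Real.exp_nat_mul, ← Real.exp_sub, Real.exp_le_exp]
  have : 0 ≤ m * (V / K) := by positivity
  calc _ = m * (V / K) * (q ^ 2 * s - (1 - q ^ 2)) := by ring
    _ ≤ m * (V / K) * (-(1 - q) ^ 2) := by
        apply mul_le_mul_of_nonneg_left _ this
        nlinarith
    _ = _ := by ring

end LowerTail

section EmpiricalVariance

lemma sum_sub_average_inner_eq {H : Type*} [NormedAddCommGroup H] [InnerProductSpace ℝ H]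
    {n : ℕ} (hn : 2 ≤ n) (f : Fin n → H) :
    (1 / ((n : ℝ) - 1)) * ∑ t, (⟪f t, f t⟫ - (1 / (n : ℝ)) * ∑ s, ⟪f t, f s⟫) =
      (∑ t, ∑ s, ‖f t - f s‖ ^ 2 / 2) / (n * (n - 1)) := by
  have hn' : (2 : ℝ) ≤ n := by exact_mod_cast hn
  have hn1 : (n : ℝ) - 1 ≠ 0 := by linarith
  have h : ∀ t s, ‖f t - f s‖ ^ 2 / 2 = ⟪f t, f t⟫ / 2 + ⟪f s, f s⟫ / 2 - ⟪f t, f s⟫ := by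
    intro t s
    rw [norm_sub_sq_real, real_inner_self_eq_norm_sq, real_inner_self_eq_norm_sq]
    ring
  simp only [h, Finset.sum_sub_distrib, Finset.sum_add_distrib, ← Finset.mul_sum,
    ← Finset.sum_div, Finset.sum_const, Finset.card_univ, Fintype.card_fin, nsmul_eq_mul]
  field_simp
  ring

lemma exp_div_cosh_add_exp_le {L : ℝ} (hL : 0 ≤ L) :
    Real.exp L / Real.cosh (2 * L) + Real.exp (-(5 * L)) ≤ 2 * Real.exp (-L) := by
  obtain ⟨y, hy⟩ : ∃ y, y = Real.exp (-L) := ⟨_, rfl⟩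
  have hy0 : 0 < y := hy ▸ Real.exp_pos _
  have hy1 : y ≤ 1 := hy ▸ Real.exp_le_one_iff.2 (by linarith)
  have e1 : Real.exp L = y⁻¹ := by rw [hy, ← Real.exp_neg, neg_neg]
  have e2 : Real.exp (2 * L) = (y ^ 2)⁻¹ := by
    rw [hy, ← Real.exp_nat_mul, ← Real.exp_neg]; congr 1; push_cast; ring
  have e3 : Real.exp (-(2 * L)) = y ^ 2 := by
    rw [hy, ← Real.exp_nat_mul]; congr 1; push_cast; ring
  have e5 : Real.exp (-(5 * L)) = y ^ 5 := by
    rw [hy, ← Real.exp_nat_mul]; congr 1; push_cast; ring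
  rw [Real.cosh_eq, e1, e2, e3, e5, ← hy]
  have h : y⁻¹ / (((y ^ 2)⁻¹ + y ^ 2) / 2) = 2 * y / (1 + y ^ 4) := by field_simp
  rw [h, ← le_sub_iff_add_le, div_le_iff₀ (by positivity)]
  have h4 : y ^ 4 ≤ 1 := pow_le_one₀ hy0.le hy1
  have h5 : 0 < y ^ 5 := by positivity
  nlinarith [mul_nonneg h5.le (sub_nonneg.2 h4)]

lemma norm_sub_integral_le_of_forall_dist {X : Type*} [MeasurableSpace X] {P : Measure X} [IsProbabilityMeasure P] {H : Type*}
    [NormedAddCommGroup H] [InnerProductSpace ℝ H] [CompleteSpace H]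
    {φ : X → H} (hφ : Integrable φ P) {D : ℝ} (hD : 0 ≤ D)
    (hdist : ∀ x y, ‖φ x - φ y‖ ^ 2 / 2 ≤ D ^ 2) (x : X) : ‖φ x - ∫ y, φ y ∂P‖ ≤ √2 * D := by
  have h : φ x - ∫ y, φ y ∂P = ∫ y, (φ x - φ y) ∂P := by
    rw [integral_sub (integrable_const _) hφ]
    simp
  rw [h]
  refine (norm_integral_le_of_norm_le_const (C := √2 * D) (.of_forall fun y => ?_)).trans
    (by simp)
  refine le_of_sq_le_sq ?_ (by positivity)
  rw [mul_pow, Real.sq_sqrt (by norm_num)]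
  linarith [hdist x y]

lemma integral_prod_norm_sub_sq_div_two {X : Type*} [MeasurableSpace X] {P : Measure X} [IsProbabilityMeasure P] {H : Type*}
    [NormedAddCommGroup H] [InnerProductSpace ℝ H] [CompleteSpace H]
    {φ : X → H} (hφ : Integrable φ P)
    (hsq : Integrable (fun x => ‖φ x - ∫ y, φ y ∂P‖ ^ 2) P)
    (hdist : Integrable (fun z : X × X => ‖φ z.1 - φ z.2‖ ^ 2 / 2) (P.prod P)) :
    ∫ z : X × X, ‖φ z.1 - φ z.2‖ ^ 2 / 2 ∂(P.prod P) = ∫ x, ‖φ x - ∫ y, φ y ∂P‖ ^ 2 ∂P := by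
  obtain ⟨μ, hμ⟩ : ∃ μ, μ = ∫ x, φ x ∂P := ⟨_, rfl⟩
  rw [← hμ] at hsq ⊢
  obtain ⟨v, hv⟩ : ∃ v, v = ∫ x, ‖φ x - μ‖ ^ 2 ∂P := ⟨_, rfl⟩
  have hint : Integrable (fun x => φ x - μ) P := hφ.sub (integrable_const μ)
  have hmean : ∫ x, (φ x - μ) ∂P = 0 := by
    rw [integral_sub hφ (integrable_const μ), ← hμ]
    simp
  rw [integral_prod _ hdist, ← hv]
  have h1 : ∀ x, ∫ y, ‖φ x - φ y‖ ^ 2 / 2 ∂P = ‖φ x - μ‖ ^ 2 / 2 + v / 2 := by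
    intro x
    have h2 : ∀ y, ‖φ x - φ y‖ ^ 2 / 2 =
        ‖φ x - μ‖ ^ 2 / 2 + ‖φ y - μ‖ ^ 2 / 2 - ⟪φ x - μ, φ y - μ⟫ := by
      intro y
      rw [show φ x - φ y = φ x - μ - (φ y - μ) by abel, norm_sub_sq_real]
      ring
    simp only [h2]
    have hc : Integrable (fun _ : X => ‖φ x - μ‖ ^ 2 / 2) P := integrable_const _
    have hadd : Integrable (fun y => ‖φ x - μ‖ ^ 2 / 2 + ‖φ y - μ‖ ^ 2 / 2) P :=
      hc.add (hsq.div_const 2)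
    rw [integral_sub hadd (hint.const_inner _), integral_add hc (hsq.div_const 2),
      integral_inner hint, hmean, integral_const, integral_div, ← hv]
    simp
  simp only [h1]
  rw [integral_add (hsq.div_const 2) (integrable_const _), integral_div, ← hv]
  simp

variable {X : Type*} [MeasurableSpace X] {H : Type*} [NormedAddCommGroup H]
  [InnerProductSpace ℝ H] [CompleteSpace H] [SecondCountableTopology H] [MeasurableSpace H]
  [BorelSpace H] {P : Measure X} [IsProbabilityMeasure P]

lemma measure_norm_sum_ge_le_exp_div_cosh {Y : X → H} (hY : Measurable Y) {D : ℝ} (hD : 0 < D)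
    (hb : ∀ x, ‖Y x‖ ≤ √2 * D) (hmean : ∫ x, Y x ∂P = 0) (n : ℕ) {L z : ℝ} (hL : 0 < L)
    (hz : 19 / 4 ≤ z) (hv : n * ∫ x, ‖Y x‖ ^ 2 ∂P ≤ z ^ 2 * D ^ 2 * L / 2) :
    (Measure.pi fun _ : Fin n => P).real {ω | D * L * (z + 7 / 12) ≤ ‖∑ i, Y (ω i)‖} ≤
      Real.exp L / Real.cosh (2 * L) := by
  obtain ⟨w, hw⟩ : ∃ w, w = z + 7 / 12 := ⟨_, rfl⟩
  have hw0 : 16 / 3 ≤ w := by linarith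
  have hwpos : 0 < w := by linarith
  have hsqrt : √2 ≤ 1.42 := Real.sqrt_le_iff.2 (by norm_num)
  have hsqrt0 : 0 ≤ √2 := Real.sqrt_nonneg 2
  have hab : 2 / (D * w) * (√2 * D) = 2 * √2 / w := by field_simp
  have hab1 : 2 * √2 / w ≤ 1 := by
    rw [div_le_one hwpos]
    linarith
  have h := measure_norm_sum_ge_le hY hb hmean n (a := 2 / (D * w)) (τ := D * L * w)
    (by positivity) (hab ▸ hab1) (by positivity)
  rw [hab, show 2 / (D * w) * (D * L * w) = 2 * L by field_simp] at h
  rw [← hw]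
  refine h.trans ?_
  gcongr
  rw [div_le_iff₀ (by linarith)]
  calc n * ((2 / (D * w)) ^ 2 * ∫ x, ‖Y x‖ ^ 2 ∂P)
      = (2 / (D * w)) ^ 2 * (n * ∫ x, ‖Y x‖ ^ 2 ∂P) := by ring
    _ ≤ (2 / (D * w)) ^ 2 * (z ^ 2 * D ^ 2 * L / 2) := by gcongr
    _ = L * (2 * (z ^ 2 / w ^ 2)) := by field_simp
    _ ≤ _ := by
        gcongr
        rw [div_le_iff₀ (by positivity)]
        have : (1 - 2 * √2 / w / 3) * w ^ 2 = w ^ 2 - 2 * √2 / 3 * w := by field_simp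
        rw [this]
        obtain rfl : z = w - 7 / 12 := by linarith
        nlinarith

/-- Deviation of the empirical mean of bounded i.i.d. vectors in a Hilbert space, controlled by the
unbiased empirical variance. -/
lemma measure_empirical_variance_bound_lt_le {φ : X → H} (hφ : Measurable φ) {C : ℝ}
    (hC : ∀ x, ‖φ x‖ ≤ C) {D : ℝ} (hD : 0 < D)
    (hdist : ∀ x y, ‖φ x - φ y‖ ^ 2 / 2 ≤ D ^ 2) {n : ℕ} (hn : 2 ≤ n) {L : ℝ}
    (hL : Real.log 2 < L) :
    (Measure.pi fun _ : Fin n => P).real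
        {ω | √(2 * ((∑ t, ∑ s, ‖φ (ω t) - φ (ω s)‖ ^ 2 / 2) / (n * (n - 1))) * L / n)
            + 16 / 3 * D * L / n < ‖(n : ℝ)⁻¹ • ∑ t, φ (ω t) - ∫ x, φ x ∂P‖} ≤
      2 * Real.exp (-L) := by
  have hlog2 := Real.log_two_gt_d9
  have hL0 : 0 < L := by linarith
  have hn' : (2 : ℝ) ≤ n := by exact_mod_cast hn
  have hn0 : (0 : ℝ) < n := by linarith
  have hn1 : (0 : ℝ) < n - 1 := by linarith
  have hφint : Integrable φ P := Integrable.of_bound hφ.aestronglyMeasurable C (.of_forall hC)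
  obtain ⟨μ, hμ⟩ : ∃ μ, μ = ∫ x, φ x ∂P := ⟨_, rfl⟩
  let Y : X → H := fun x => φ x - μ
  have hY : Measurable Y := hφ.sub_const μ
  have hYint : Integrable Y P := hφint.sub (integrable_const μ)
  have hYmean : ∫ x, Y x ∂P = 0 := by
    simp only [Y]
    rw [integral_sub hφint (integrable_const μ), ← hμ]
    simp
  have hYb : ∀ x, ‖Y x‖ ≤ √2 * D := by
    intro x
    simp only [Y, hμ]
    exact norm_sub_integral_le_of_forall_dist hφint hD.le hdist x
  obtain ⟨v, hv⟩ : ∃ v, v = ∫ x, ‖Y x‖ ^ 2 ∂P := ⟨_, rfl⟩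
  have hsq : Integrable (fun x => ‖Y x‖ ^ 2) P := by
    refine Integrable.of_bound (C := (√2 * D) ^ 2) (hY.norm.pow_const 2).aestronglyMeasurable
      (.of_forall fun x => ?_)
    rw [Real.norm_eq_abs, abs_of_nonneg (by positivity)]
    exact pow_le_pow_left₀ (norm_nonneg _) (hYb x) 2
  have hv0 : 0 ≤ v := hv ▸ integral_nonneg fun x => by positivity
  have hhm : Measurable (Function.uncurry fun x y => ‖φ x - φ y‖ ^ 2 / 2) :=
    (((hφ.comp measurable_fst).sub (hφ.comp measurable_snd)).norm.pow_const 2).div_const 2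
  have hhint : Integrable (fun z : X × X => ‖φ z.1 - φ z.2‖ ^ 2 / 2) (P.prod P) := by
    refine Integrable.of_bound (C := D ^ 2) hhm.aestronglyMeasurable (.of_forall fun z => ?_)
    rw [Real.norm_eq_abs, abs_of_nonneg (by positivity)]
    exact hdist _ _
  have hV : ∫ z : X × X, ‖φ z.1 - φ z.2‖ ^ 2 / 2 ∂(P.prod P) = v := by
    rw [integral_prod_norm_sub_sq_div_two hφint (hμ ▸ hsq) hhint, hv, ← hμ]
  have hvD : v ≤ D ^ 2 := by
    rw [← hV]
    refine (integral_mono hhint (integrable_const (D ^ 2)) fun z => hdist _ _).trans ?_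
    simp
  have hmean : ∀ ω : Fin n → X, ‖(n : ℝ)⁻¹ • ∑ t, φ (ω t) - ∫ x, φ x ∂P‖ =
      ‖∑ t, Y (ω t)‖ / n := by
    intro ω
    have : (n : ℝ)⁻¹ • ∑ t, φ (ω t) - μ = (n : ℝ)⁻¹ • ∑ t, Y (ω t) := by
      simp only [Y, Finset.sum_sub_distrib, smul_sub, Finset.sum_const, Finset.card_univ,
        Fintype.card_fin]
      rw [← Nat.cast_smul_eq_nsmul ℝ, smul_smul, inv_mul_cancel₀ hn0.ne', one_smul]
    rw [← hμ, this, norm_smul, Real.norm_of_nonneg (by positivity), inv_mul_eq_div]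
  let U : (Fin n → X) → ℝ := fun ω =>
    (∑ t, ∑ s, ‖φ (ω t) - φ (ω s)‖ ^ 2 / 2) / (n * (n - 1))
  change (Measure.pi fun _ : Fin n => P).real
    {ω | √(2 * U ω * L / n) + 16 / 3 * D * L / n < _} ≤ _
  simp only [hmean]
  have htail := exp_div_cosh_add_exp_le hL0.le
  rcases le_or_gt (n * v) ((19 / 4) ^ 2 * D ^ 2 * L / 2) with hsmall | hlarge
  · refine (measureReal_mono fun ω hω => ?_).trans
      ((measure_norm_sum_ge_le_exp_div_cosh hY hD hYb hYmean n hL0 le_rfl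
        (hv ▸ hsmall)).trans (by linarith [Real.exp_pos (-(5 * L))]))
    simp only [Set.mem_ofPred_eq] at hω ⊢
    have h1 : 16 / 3 * D * L / n < ‖∑ t, Y (ω t)‖ / n := by
      linarith [Real.sqrt_nonneg (2 * U ω * L / n)]
    rw [div_lt_div_iff_of_pos_right hn0] at h1
    linarith
  obtain ⟨z, hz0, hz⟩ : ∃ z : ℝ, 0 ≤ z ∧ n * v = z ^ 2 * D ^ 2 * L / 2 :=
    ⟨√(2 * (n * v) / (D ^ 2 * L)), Real.sqrt_nonneg _, by
      rw [Real.sq_sqrt (by positivity)]; field_simp⟩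
  have hz1 : 19 / 4 < z := by
    rw [hz] at hlarge
    refine lt_of_pow_lt_pow_left₀ 2 hz0 ?_
    have : 0 < D ^ 2 * L / 2 := by positivity
    nlinarith
  have hzpos : 0 < z := by linarith
  have hn8 : 8 ≤ n := by
    have h1 : z ^ 2 * D ^ 2 * L / 2 ≤ n * D ^ 2 := hz ▸ by gcongr
    have h2 : z ^ 2 * L / 2 ≤ n := by
      refine le_of_mul_le_mul_right ?_ (by positivity : 0 < D ^ 2)
      linarith
    have h3 : (7 : ℝ) < n := by nlinarith
    exact_mod_cast h3
  have hm : (4 / 9 : ℝ) * n ≤ (n / 2 : ℕ) := by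
    have : 4 * n ≤ 9 * (n / 2) := by omega
    have : (4 : ℝ) * n ≤ 9 * (n / 2 : ℕ) := by exact_mod_cast this
    linarith
  obtain ⟨q, hq⟩ : ∃ q, q = 1 - 19 / (4 * z) := ⟨_, rfl⟩
  have hqz : q * z = z - 19 / 4 := by rw [hq]; field_simp
  have hq0 : 0 < q := by
    rw [hq, sub_pos, div_lt_one (by positivity)]
    linarith
  have hq1 : q ≤ 1 := by
    rw [hq, sub_le_self_iff]
    positivity
  have hdev := measure_norm_sum_ge_le_exp_div_cosh hY hD hYb hYmean n hL0 hz1.le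
    (le_of_eq (hv ▸ hz))
  have hlow : (Measure.pi fun _ : Fin n => P).real {ω | U ω ≤ q ^ 2 * v} ≤ _ :=
    measure_pairAverage_le_le (P := P) hhm (fun x y => by positivity)
      (by positivity : 0 < D ^ 2) hdist (fun x => by simp) hn (Nat.mul_div_le n 2) hV hq0 hq1
  have hlow5 : Real.exp (-((n / 2 : ℕ) * (v / D ^ 2) * (1 - q) ^ 2)) ≤ Real.exp (-(5 * L)) := by
    rw [Real.exp_le_exp, neg_le_neg_iff]
    have hvz : v / D ^ 2 = z ^ 2 * L / (2 * n) := by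
      rw [div_eq_div_iff (by positivity) (by positivity)]
      linarith
    calc 5 * L ≤ 4 / 9 * (361 / 32) * L := by gcongr; norm_num
      _ = 4 / 9 * n * (v / D ^ 2) * (1 - q) ^ 2 := by
          rw [hvz, hq]; field_simp; ring
      _ ≤ _ := by gcongr
  have hunion : (Measure.pi fun _ : Fin n => P).real
      ({ω | D * L * (z + 7 / 12) ≤ ‖∑ i, Y (ω i)‖} ∪ {ω | U ω ≤ q ^ 2 * v}) ≤
        2 * Real.exp (-L) :=
    (measureReal_union_le _ _).trans ((add_le_add hdev (hlow.trans hlow5)).trans htail)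
  refine le_trans (measureReal_mono (fun ω hω => ?_) (measure_ne_top _ _)) hunion
  by_contra hcon
  simp only [Set.mem_union, Set.mem_ofPred_eq, not_or, not_le] at hω hcon
  obtain ⟨h1, h2⟩ := hcon
  have hsq : D * L * (z - 19 / 4) / n ≤ √(2 * U ω * L / n) := by
    apply Real.le_sqrt_of_sq_le
    have : (D * L * (z - 19 / 4) / n) ^ 2 = 2 * (q ^ 2 * v) * L / n := by
      rw [← hqz]
      have : v = z ^ 2 * D ^ 2 * L / 2 / n := by rw [← hz]; field_simp
      rw [this]; field_simp
    rw [this]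
    gcongr
  have h3 : ‖∑ t, Y (ω t)‖ / n < D * L * (z + 7 / 12) / n := by gcongr
  have h4 : D * L * (z + 7 / 12) / n = D * L * (z - 19 / 4) / n + 16 / 3 * D * L / n := by
    field_simp; ring
  linarith

end EmpiricalVariance

/-- Empirical-variance high-confidence convergence rate, general kernel.
With probability at least `1 − δ`,
`‖μ̂_n − μ_P‖ ≤ √(2(v̂ + Δdiag k) log(2/δ)/n) + ((16/3)√Δk + 2√2·√Δdiag k) log(2/δ)/n`. -/
theorem empirical_variance_rate_general_kernel
    {X : Type*} [MeasurableSpace X] [Nonempty X]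
    {H : Type*} [NormedAddCommGroup H] [InnerProductSpace ℝ H] [CompleteSpace H]
    [SecondCountableTopology H] [MeasurableSpace H] [BorelSpace H]
    (φ : X → H) (hφ_meas : Measurable φ) (C : ℝ) (hφ_bdd : ∀ x, ‖φ x‖ ≤ C)
    (k : X → X → ℝ) (hk : ∀ x y, k x y = ⟪φ x, φ y⟫)
    (kSup kInf : ℝ)
    (hkSup : IsLUB (Set.range fun p : X × X => k p.1 p.2) kSup)
    (hkInf : IsGLB (Set.range fun p : X × X => k p.1 p.2) kInf)
    (dSup dInf : ℝ)
    (hdSup : IsLUB (Set.range fun x => k x x) dSup)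
    (hdInf : IsGLB (Set.range fun x => k x x) dInf)
    (Δk Δdiag : ℝ) (hΔk : Δk = kSup - kInf) (hΔdiag : Δdiag = dSup - dInf)
    (hΔk_pos : 0 < Δk)
    (P : Measure X) [IsProbabilityMeasure P]
    (μP : H) (hμP : μP = ∫ x, φ x ∂P)
    (n : ℕ) (hn : 2 ≤ n)
    (vhat : (Fin n → X) → ℝ)
    (hvhat : ∀ x, vhat x = (1 / ((n : ℝ) - 1)) *
      ∑ t : Fin n, (k (x t) (x t) - (1 / (n : ℝ)) * ∑ s : Fin n, k (x t) (x s)))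
    (δ : ℝ) (hδ : δ ∈ Set.Ioo (0 : ℝ) 1) :
    ENNReal.ofReal (1 - δ) ≤
      (Measure.pi fun _ : Fin n => P)
        {ω | ‖(n : ℝ)⁻¹ • (∑ t, φ (ω t)) - μP‖ ≤
          Real.sqrt (2 * (vhat ω + Δdiag) * Real.log (2 / δ) / n)
            + ((16 / 3) * Real.sqrt Δk + 2 * Real.sqrt 2 * Real.sqrt Δdiag)
              * Real.log (2 / δ) / n} := by
  have hk_le : ∀ x y, k x y ≤ kSup := fun x y => hkSup.1 ⟨(x, y), rfl⟩
  have hk_ge : ∀ x y, kInf ≤ k x y := fun x y => hkInf.1 ⟨(x, y), rfl⟩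
  have hΔdiag0 : 0 ≤ Δdiag := by
    obtain ⟨x⟩ := ‹Nonempty X›
    have h1 : k x x ≤ dSup := hdSup.1 ⟨x, rfl⟩
    have h2 : dInf ≤ k x x := hdInf.1 ⟨x, rfl⟩
    linarith
  have hdist : ∀ x y, ‖φ x - φ y‖ ^ 2 / 2 ≤ √Δk ^ 2 := by
    intro x y
    rw [Real.sq_sqrt hΔk_pos.le, norm_sub_sq_real, ← real_inner_self_eq_norm_sq,
      ← real_inner_self_eq_norm_sq, ← hk, ← hk, ← hk]
    linarith [hk_le x x, hk_le y y, hk_ge x y]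
  obtain ⟨L, hL⟩ : ∃ L, L = Real.log (2 / δ) := ⟨_, rfl⟩
  have hL2 : Real.log 2 < L := by
    rw [hL]
    apply Real.log_lt_log (by norm_num)
    rw [lt_div_iff₀ hδ.1]
    linarith [hδ.2]
  have hL0 : 0 < L := (Real.log_pos (by norm_num)).trans hL2
  have hδL : 2 * Real.exp (-L) = δ := by
    rw [hL, ← Real.log_inv, Real.exp_log (by have := hδ.1; positivity)]
    field_simp
  have hbad := measure_empirical_variance_bound_lt_le (P := P) hφ_meas hφ_bdd
    (Real.sqrt_pos.2 hΔk_pos) hdist hn hL2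
  rw [hδL, ← hμP] at hbad
  rw [← hL]
  have hsub : {ω : Fin n → X | ‖(n : ℝ)⁻¹ • (∑ t, φ (ω t)) - μP‖ ≤
      Real.sqrt (2 * (vhat ω + Δdiag) * L / n)
        + ((16 / 3) * Real.sqrt Δk + 2 * Real.sqrt 2 * Real.sqrt Δdiag) * L / n}ᶜ ⊆
      {ω | √(2 * ((∑ t, ∑ s, ‖φ (ω t) - φ (ω s)‖ ^ 2 / 2) / (n * (n - 1))) * L / n)
        + 16 / 3 * √Δk * L / n < ‖(n : ℝ)⁻¹ • ∑ t, φ (ω t) - μP‖} := by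
    intro ω hω
    simp only [Set.mem_compl_iff, Set.mem_ofPred_eq, not_le] at hω ⊢
    refine lt_of_le_of_lt ?_ hω
    have hv : vhat ω = (∑ t, ∑ s, ‖φ (ω t) - φ (ω s)‖ ^ 2 / 2) / (n * (n - 1)) := by
      rw [← sum_sub_average_inner_eq hn, hvhat]
      simp only [hk]
    rw [← hv]
    gcongr
    · linarith
    · have : 0 ≤ 2 * √2 * √Δdiag := by positivity
      linarith
  have hcompl := (measureReal_mono (μ := Measure.pi fun _ : Fin n => P) hsub).trans hbad
  refine (ENNReal.ofReal_le_iff_le_toReal (measure_ne_top _ _)).2 ?_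
  set S := {ω : Fin n → X | ‖(n : ℝ)⁻¹ • (∑ t, φ (ω t)) - μP‖ ≤
      Real.sqrt (2 * (vhat ω + Δdiag) * L / n)
        + ((16 / 3) * Real.sqrt Δk + 2 * Real.sqrt 2 * Real.sqrt Δdiag) * L / n}
  have hunion := measureReal_union_le (μ := Measure.pi fun _ : Fin n => P) S Sᶜ
  rw [Set.union_compl_self, probReal_univ] at hunion
  change 1 - δ ≤ (Measure.pi fun _ : Fin n => P).real S
  linarith
end

section
/- (Consistency of the test under the alternative.) Let {P_θ : θ ∈ Θ} be a family of probability measures on X and P a probability measure with Δ := inf_{θ∈Θ} ‖μ_P − μ_{P_θ}‖ > 0. Fix α ∈ (0,1) and let B : ℕ × (0,1) → ℝ satisfy: (a) B(n, α) → 0 as n → ∞; (b) there is a sequence αₙ → 0 with B(n, αₙ) → 0 as n → ∞; (c) for every n and every α' ∈ (0,1), with probability at least 1 − α' over an i.i.d. sample X_1, …, X_n from P, ‖μ̂_n − μ_P‖ ≤ B(n, α'). Then there exists N such that for all n ≥ N, the probability that inf_{θ∈Θ} ‖μ̂_n − μ_{P_θ}‖ ≤ B(n, α) is at most αₙ; in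 particular the probability of rejecting H₀ tends to 1. -/
open MeasureTheory Filter

/-- The distance from a point to an indexed family is `1`-Lipschitz in the point. -/
theorem iInf_norm_sub_le_norm_sub_add {E ι : Type*} [SeminormedAddCommGroup E] [Nonempty ι]
    (f : ι → E) (x y : E) :
    ⨅ i, ‖x - f i‖ ≤ ‖y - x‖ + ⨅ i, ‖y - f i‖ := by
  rw [← sub_le_iff_le_add']
  refine le_ciInf fun i => sub_le_iff_le_add'.2 ?_
  have hbdd : BddBelow (Set.range fun i => ‖x - f i‖) :=
    ⟨0, by rintro _ ⟨j, rfl⟩; exact norm_nonneg _⟩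
  calc ⨅ i, ‖x - f i‖ ≤ ‖x - f i‖ := ciInf_le hbdd i
    _ ≤ ‖x - y‖ + ‖y - f i‖ := norm_sub_le_norm_sub_add_norm_sub x y (f i)
    _ = ‖y - x‖ + ‖y - f i‖ := by rw [norm_sub_rev x y]

/-- Consistency of the test under the alternative. If
`Δ = inf_θ ‖μ_P − μ_{P_θ}‖ > 0` and the threshold family `B` satisfies (a), (b), (c),
then eventually the probability of not rejecting `H₀` is at most `αₙ`; in particular the
probability of rejecting `H₀` tends to `1`. -/
theorem mmd_test_consistency
    {X : Type*} [MeasurableSpace X]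
    {H : Type*} [NormedAddCommGroup H] [InnerProductSpace ℝ H] [CompleteSpace H]
    [SecondCountableTopology H] [MeasurableSpace H] [BorelSpace H]
    (φ : X → H) (hφ_meas : Measurable φ) (C : ℝ) (hφ_bdd : ∀ x, ‖φ x‖ ≤ C)
    {Θ : Type*} (Pθ : Θ → Measure X) (hPθ : ∀ θ, IsProbabilityMeasure (Pθ θ))
    (P : Measure X) [IsProbabilityMeasure P]
    (Δ : ℝ) (hΔ : Δ = ⨅ θ : Θ, ‖(∫ x, φ x ∂P) - ∫ x, φ x ∂(Pθ θ)‖) (hΔ_pos : 0 < Δ)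
    (α : ℝ) (hα : α ∈ Set.Ioo (0 : ℝ) 1)
    (B : ℕ → ℝ → ℝ)
    (ha : Tendsto (fun n => B n α) atTop (nhds 0))
    (αseq : ℕ → ℝ) (hαseq_mem : ∀ n, αseq n ∈ Set.Ioo (0 : ℝ) 1)
    (hαseq : Tendsto αseq atTop (nhds 0))
    (hb : Tendsto (fun n => B n (αseq n)) atTop (nhds 0))
    (hc : ∀ n : ℕ, 0 < n → ∀ α' ∈ Set.Ioo (0 : ℝ) 1,
      ENNReal.ofReal (1 - α') ≤
        (Measure.pi fun _ : Fin n => P)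
          {ω | ‖(n : ℝ)⁻¹ • (∑ t, φ (ω t)) - ∫ x, φ x ∂P‖ ≤ B n α'}) :
    (∃ N : ℕ, ∀ n ≥ N,
      (Measure.pi fun _ : Fin n => P)
        {ω | (⨅ θ : Θ, ‖(n : ℝ)⁻¹ • (∑ t, φ (ω t)) - ∫ x, φ x ∂(Pθ θ)‖) ≤ B n α} ≤
        ENNReal.ofReal (αseq n)) ∧
    Tendsto (fun n : ℕ =>
      (Measure.pi fun _ : Fin n => P)
        {ω | B n α < ⨅ θ : Θ, ‖(n : ℝ)⁻¹ • (∑ t, φ (ω t)) - ∫ x, φ x ∂(Pθ θ)‖})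
      atTop (nhds 1) := by
  have hΘ : Nonempty Θ := by
    by_contra h
    rw [not_nonempty_iff] at h
    simp [hΔ] at hΔ_pos
  have hev : ∀ᶠ n in atTop, 0 < n ∧ B n α + B n (αseq n) < Δ := by
    have hsum := ha.add hb
    rw [add_zero] at hsum
    exact (eventually_gt_atTop 0).and (hsum.eventually_lt_const hΔ_pos)
  have hsub : ∀ n, B n α + B n (αseq n) < Δ →
      {ω : Fin n → X | ‖(n : ℝ)⁻¹ • (∑ t, φ (ω t)) - ∫ x, φ x ∂P‖ ≤ B n (αseq n)} ⊆
        {ω | B n α < ⨅ θ : Θ, ‖(n : ℝ)⁻¹ • (∑ t, φ (ω t)) - ∫ x, φ x ∂(Pθ θ)‖} := by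
    intro n hn ω hω
    have h := iInf_norm_sub_le_norm_sub_add (fun θ => ∫ x, φ x ∂(Pθ θ)) (∫ x, φ x ∂P)
      ((n : ℝ)⁻¹ • (∑ t, φ (ω t)))
    rw [← hΔ] at h
    simp only [Set.mem_ofPred_eq] at hω ⊢
    linarith
  constructor
  · obtain ⟨N, hN⟩ := eventually_atTop.1 hev
    refine ⟨N, fun n hn => ?_⟩
    obtain ⟨hn_pos, hlt⟩ := hN n hn
    have hmeas : MeasurableSet
        {ω : Fin n → X | ‖(n : ℝ)⁻¹ • (∑ t, φ (ω t)) - ∫ x, φ x ∂P‖ ≤ B n (αseq n)} := by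
      refine measurableSet_le ?_ measurable_const
      fun_prop
    calc _ ≤ (Measure.pi fun _ : Fin n => P)
          {ω | ‖(n : ℝ)⁻¹ • (∑ t, φ (ω t)) - ∫ x, φ x ∂P‖ ≤ B n (αseq n)}ᶜ := by
            refine measure_mono fun ω hω hω' => ?_
            have h := hsub n hlt hω'
            rw [Set.mem_ofPred_eq] at h hω
            exact not_lt_of_ge hω h
      _ ≤ 1 - ENNReal.ofReal (1 - αseq n) := by
          rw [prob_compl_eq_one_sub hmeas]
          exact tsub_le_tsub_left (hc n hn_pos _ (hαseq_mem n)) 1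
      _ = ENNReal.ofReal (αseq n) := by
          rw [← ENNReal.ofReal_one, ← ENNReal.ofReal_sub _ (by linarith [(hαseq_mem n).2]),
            sub_sub_cancel]
  · have hlim : Tendsto (fun n => ENNReal.ofReal (1 - αseq n)) atTop (nhds 1) := by
      simpa using ENNReal.tendsto_ofReal (hαseq.const_sub 1)
    refine tendsto_of_tendsto_of_tendsto_of_le_of_le' hlim tendsto_const_nhds ?_
      (Eventually.of_forall fun n => prob_le_one)
    filter_upwards [hev] with n ⟨hn_pos, hlt⟩
    exact (hc n hn_pos _ (hαseq_mem n)).trans (measure_mono (hsub n hlt))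
end

section
/- (Variance under Hüber contamination.) Let ψ : ℝ^d → ℝ be a bounded even measurable function with ψ(0) = sup ψ =: ψ̄, ψ̲ := inf ψ, Δψ := ψ̄ − ψ̲. Let P = (1 − ξ) P₀ + ξ H with ξ ∈ [0, 1/2), P₀ and H probability measures on ℝ^d, and set v = v(P), v₀ = v(P₀), where v(Q) = ψ̄ − ∫∫ ψ(x' − x) dQ(x) dQ(x'). Then: v ≤ v₀ + 2ξ(Δψ − v₀) + ξ²(v₀ − Δψ); moreover, if ψ ≥ 0 then v ≤ (1 − 2ξ) v₀ + 2ξ ψ̄, and in general v ≤ (1 − 2ξ) v₀ + 2ξ Δψ. -/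
open MeasureTheory

/-- Bilinear expansion of an integral against the product of a two-component mixture with itself. -/
theorem integral_prod_mixture {α : Type*} [MeasurableSpace α] {f : α × α → ℝ}
    (μ ν : Measure α) [IsProbabilityMeasure μ] [IsProbabilityMeasure ν] {a b : ℝ}
    (ha : 0 ≤ a) (hb : 0 ≤ b)
    (hf : ∀ (ρ σ : Measure α) [IsProbabilityMeasure ρ] [IsProbabilityMeasure σ],
      Integrable f (ρ.prod σ)) :
    ∫ p, f p ∂((ENNReal.ofReal a • μ + ENNReal.ofReal b • ν).prod
        (ENNReal.ofReal a • μ + ENNReal.ofReal b • ν)) =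
      a * (a * ∫ p, f p ∂(μ.prod μ)) + a * (b * ∫ p, f p ∂(μ.prod ν)) +
        (b * (a * ∫ p, f p ∂(ν.prod μ)) + b * (b * ∫ p, f p ∂(ν.prod ν))) := by
  have hsmul : ∀ (c e : ℝ) (ρ σ : Measure α) [IsProbabilityMeasure ρ] [IsProbabilityMeasure σ],
      Integrable f (ENNReal.ofReal c • ENNReal.ofReal e • ρ.prod σ) := fun c e ρ σ _ _ =>
    ((hf ρ σ).smul_measure ENNReal.ofReal_ne_top).smul_measure ENNReal.ofReal_ne_top
  simp only [Measure.prod_add, Measure.add_prod, Measure.prod_smul_left, Measure.prod_smul_right,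
    smul_add]
  rw [integral_add_measure, integral_add_measure, integral_add_measure]
  · simp only [integral_smul_measure, ENNReal.toReal_ofReal ha, ENNReal.toReal_ofReal hb,
      smul_eq_mul]
    ring
  all_goals simp only [integrable_add_measure, hsmul, and_self]

/-- Variance under Hüber contamination. For
`P = (1 − ξ)P₀ + ξH` with `ξ ∈ [0, 1/2)`:
`v ≤ v₀ + 2ξ(Δψ − v₀) + ξ²(v₀ − Δψ)`; if `ψ ≥ 0` then `v ≤ (1 − 2ξ)v₀ + 2ξψ̄`, and in
general `v ≤ (1 − 2ξ)v₀ + 2ξΔψ`. -/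
theorem variance_huber_contamination
    (d : ℕ)
    (ψ : (Fin d → ℝ) → ℝ) (hψ_meas : Measurable ψ)
    (hψ_even : ∀ y, ψ (-y) = ψ y)
    (hψ_sup : ∀ y, ψ y ≤ ψ 0)
    (ψInf : ℝ) (hψInf : IsGLB (Set.range ψ) ψInf)
    (Δψ : ℝ) (hΔψ : Δψ = ψ 0 - ψInf)
    (ξ : ℝ) (hξ : ξ ∈ Set.Ico (0 : ℝ) (1 / 2))
    (P₀ Hm : Measure (Fin d → ℝ)) [IsProbabilityMeasure P₀] [IsProbabilityMeasure Hm]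
    (P : Measure (Fin d → ℝ))
    (hP : P = ENNReal.ofReal (1 - ξ) • P₀ + ENNReal.ofReal ξ • Hm)
    (v v₀ : ℝ)
    (hv : v = ψ 0 - ∫ p, ψ (p.2 - p.1) ∂(P.prod P))
    (hv₀ : v₀ = ψ 0 - ∫ p, ψ (p.2 - p.1) ∂(P₀.prod P₀)) :
    v ≤ v₀ + 2 * ξ * (Δψ - v₀) + ξ ^ 2 * (v₀ - Δψ) ∧
    ((∀ y, 0 ≤ ψ y) → v ≤ (1 - 2 * ξ) * v₀ + 2 * ξ * ψ 0) ∧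
    v ≤ (1 - 2 * ξ) * v₀ + 2 * ξ * Δψ := by
  obtain ⟨hξ0, hξ1⟩ := hξ
  have hInf : ∀ y, ψInf ≤ ψ y := fun y => hψInf.1 ⟨y, rfl⟩
  have hint : ∀ (μ ν : Measure (Fin d → ℝ)) [IsProbabilityMeasure μ] [IsProbabilityMeasure ν],
      Integrable (fun p : (Fin d → ℝ) × (Fin d → ℝ) => ψ (p.2 - p.1)) (μ.prod ν) :=
    fun μ ν _ _ => Integrable.of_mem_Icc ψInf (ψ 0)
      (hψ_meas.comp (measurable_snd.sub measurable_fst)).aemeasurable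
      (Filter.Eventually.of_forall fun p => ⟨hInf _, hψ_sup _⟩)
  have hlower : ∀ (μ ν : Measure (Fin d → ℝ)) [IsProbabilityMeasure μ] [IsProbabilityMeasure ν],
      ψInf ≤ ∫ p, ψ (p.2 - p.1) ∂(μ.prod ν) := fun μ ν _ _ => by
    simpa using integral_mono (integrable_const ψInf) (hint μ ν) (fun p => hInf _)
  rw [hP, integral_prod_mixture P₀ Hm (by linarith) hξ0 hint] at hv
  have h00 := hlower P₀ P₀
  have hmain : v ≤ v₀ + 2 * ξ * (Δψ - v₀) + ξ ^ 2 * (v₀ - Δψ) := by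
    have hcross : 0 ≤ (1 - ξ) * ξ := mul_nonneg (by linarith) hξ0
    have h0H := mul_le_mul_of_nonneg_left (hlower P₀ Hm) hcross
    have hH0 := mul_le_mul_of_nonneg_left (hlower Hm P₀) hcross
    have hHH := mul_le_mul_of_nonneg_left (hlower Hm Hm) (mul_nonneg hξ0 hξ0)
    subst hv hv₀ hΔψ
    linarith
  have hgeneral : v ≤ (1 - 2 * ξ) * v₀ + 2 * ξ * Δψ := by
    have hle : 0 ≤ ξ ^ 2 * (Δψ - v₀) := mul_nonneg (sq_nonneg ξ) (by linarith)
    linarith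
  refine ⟨hmain, fun hψ_nonneg => hgeneral.trans ?_, hgeneral⟩
  have hInf_nonneg : 0 ≤ ψInf := hψInf.2 (by rintro _ ⟨y, rfl⟩; exact hψ_nonneg y)
  have hle : ξ * Δψ ≤ ξ * ψ 0 := mul_le_mul_of_nonneg_left (by linarith) hξ0
  linarith
end
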